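/- arXiv:math/0201124 — 2 statements merged into one kernel-verified Lean document; each statement's English description precedes it below -/
import Mathlib

section
/- Let R be a commutative ring, t an element of R, and A an associative R-algebra. Suppose x : ℤ → A is a family of elements satisfying, for all m, n ∈ ℤ, the quadratic relation x(m+1)x(n) + x(n+1)x(m) = t·(x(m)x(n+1) + x(n)x(m+1)). Then for all m₁, m₂, m₃ ∈ ℤ, the sum over all permutations σ of {1,2,3} of [ − x(m_{σ(1)}+1)·x(m_{σ(2)})·x(m_{σ(3)}) + (t + t²)·x(m_{σ(1)})·x(m_{σ(2)}+1)·x(m_{σ(3)}) − t³·x(m_{σ(1)})·x(m_{σ(2)})·x(m_{σ(3)}+1) ] equals 0. -/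
open scoped BigOperators

/-- A sum over the permutations of `Fin 3`, written out in terms of the values `σ 0, σ 1, σ 2`. -/
theorem sum_perm_fin_three {M : Type*} [AddCommMonoid M] (f : Fin 3 → Fin 3 → Fin 3 → M) :
    ∑ σ : Equiv.Perm (Fin 3), f (σ 0) (σ 1) (σ 2)
      = f 0 1 2 + f 0 2 1 + f 1 0 2 + f 1 2 0 + f 2 0 1 + f 2 1 0 := by
  have huniv : (Finset.univ : Finset (Equiv.Perm (Fin 3)))
      = {1, Equiv.swap 1 2, Equiv.swap 0 1, Equiv.swap 0 1 * Equiv.swap 1 2,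
          Equiv.swap 1 2 * Equiv.swap 0 1, Equiv.swap 0 2} := by decide
  rw [huniv]
  repeat rw [Finset.sum_insert (by decide)]
  rw [Finset.sum_singleton]
  simp only [← add_assoc]
  rfl

/-- coefficientwise symmetrization identity
`Sym_{z₁,z₂,z₃}{(−z₁ + (t+t²)z₂ − t³z₃)·X(z₁)X(z₂)X(z₃)} = 0`
for a current satisfying the quantum affine sl₂ quadratic relation. -/
theorem symmetrization_identity_linear
    {R : Type*} {A : Type*} [CommRing R] [Ring A] [Algebra R A]
    (t : R) (x : ℤ → A)
    (hx : ∀ m n : ℤ,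
      x (m + 1) * x n + x (n + 1) * x m
        = t • (x m * x (n + 1) + x n * x (m + 1))) :
    ∀ m₁ m₂ m₃ : ℤ,
      (∑ σ : Equiv.Perm (Fin 3),
        (-(x (![m₁, m₂, m₃] (σ 0) + 1) * x (![m₁, m₂, m₃] (σ 1)) * x (![m₁, m₂, m₃] (σ 2)))
          + (t + t ^ 2) • (x (![m₁, m₂, m₃] (σ 0)) * x (![m₁, m₂, m₃] (σ 1) + 1)
              * x (![m₁, m₂, m₃] (σ 2)))
          - t ^ 3 • (x (![m₁, m₂, m₃] (σ 0)) * x (![m₁, m₂, m₃] (σ 1))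
              * x (![m₁, m₂, m₃] (σ 2) + 1)))) = 0 := by
  intro m₁ m₂ m₃
  have hright (a b c : ℤ) : x (a + 1) * x b * x c + x (b + 1) * x a * x c
      = t • (x a * x (b + 1) * x c + x b * x (a + 1) * x c) := by
    simpa only [add_mul, smul_mul_assoc] using congrArg (· * x c) (hx a b)
  have hleft (a b c : ℤ) : x c * x (a + 1) * x b + x c * x (b + 1) * x a
      = t • (x c * x a * x (b + 1) + x c * x b * x (a + 1)) := by
    simpa only [mul_add, mul_smul_comm, mul_assoc] using congrArg (x c * ·) (hx a b)
  rw [sum_perm_fin_three fun i j k ↦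
    -(x (![m₁, m₂, m₃] i + 1) * x (![m₁, m₂, m₃] j) * x (![m₁, m₂, m₃] k))
      + (t + t ^ 2) • (x (![m₁, m₂, m₃] i) * x (![m₁, m₂, m₃] j + 1) * x (![m₁, m₂, m₃] k))
      - t ^ 3 • (x (![m₁, m₂, m₃] i) * x (![m₁, m₂, m₃] j) * x (![m₁, m₂, m₃] k + 1))]
  simp only [Matrix.cons_val]
  -- `-z₁ + (t + t²) z₂ - t³ z₃ = -(z₁ - t z₂) + t² (z₂ - t z₃)`
  linear_combination (norm := module)
    t ^ 2 • (hleft m₁ m₂ m₃ + hleft m₁ m₃ m₂ + hleft m₂ m₃ m₁)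
      - (hright m₁ m₂ m₃ + hright m₁ m₃ m₂ + hright m₂ m₃ m₁)
end

section
/- Let K be a field and let a, w, z₁, z₂ ∈ K be nonzero elements with a·z_i ≠ w and a·w ≠ z_i for i = 1, 2. Define G(z₁, z₂) = [ 1/((1−a z₁/w)(1−a z₂/w)) + (a + a^{−1})·(w/z₁)·1/((1−a w/z₁)(1−a z₂/w)) + (w²/(z₁z₂))·1/((1−a w/z₁)(1−a w/z₂)) ] · (z₁ − a²z₂)(z₁ − z₂). Then G(z₁, z₂) + G(z₂, z₁) = 0. -/
/-- vanishing of the symmetrization in `z₁, z₂` of the three-term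
contraction expression, verifying the Drinfel'd–Serre relation (2.15). -/
theorem symmetrization_vanishes {K : Type*} [Field K]
    (a w z₁ z₂ : K) (ha : a ≠ 0) (hw : w ≠ 0) (hz₁ : z₁ ≠ 0) (hz₂ : z₂ ≠ 0)
    (h1 : a * z₁ ≠ w) (h2 : a * z₂ ≠ w)
    (h1' : a * w ≠ z₁) (h2' : a * w ≠ z₂) :
    (1 / ((1 - a * z₁ / w) * (1 - a * z₂ / w))
        + (a + a⁻¹) * (w / z₁) * (1 / ((1 - a * w / z₁) * (1 - a * z₂ / w)))
        + (w ^ 2 / (z₁ * z₂)) * (1 / ((1 - a * w / z₁) * (1 - a * w / z₂))))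
      * ((z₁ - a ^ 2 * z₂) * (z₁ - z₂))
    + (1 / ((1 - a * z₂ / w) * (1 - a * z₁ / w))
        + (a + a⁻¹) * (w / z₂) * (1 / ((1 - a * w / z₂) * (1 - a * z₁ / w)))
        + (w ^ 2 / (z₂ * z₁)) * (1 / ((1 - a * w / z₂) * (1 - a * w / z₁))))
      * ((z₂ - a ^ 2 * z₁) * (z₂ - z₁)) = 0 := by
  have hA₁_ne : w - a * z₁ ≠ 0 := sub_ne_zero.mpr h1.symm
  have hA₂_ne : w - a * z₂ ≠ 0 := sub_ne_zero.mpr h2.symm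
  have hB₁_ne : z₁ - a * w ≠ 0 := sub_ne_zero.mpr h1'.symm
  have hB₂_ne : z₂ - a * w ≠ 0 := sub_ne_zero.mpr h2'.symm
  rw [one_sub_div hw, one_sub_div hw, one_sub_div hz₁, one_sub_div hz₂]
  generalize hA₁ : w - a * z₁ = A₁ at *
  generalize hA₂ : w - a * z₂ = A₂ at *
  generalize hB₁ : z₁ - a * w = B₁ at *
  generalize hB₂ : z₂ - a * w = B₂ at *
  field_simp
  subst hA₁ hA₂ hB₁ hB₂
  ring
end
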